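/- For each j let X_j = {x_{b,a} ∈ X : b_{l_j} ≤ b ≤ d_j, c_j ≤ a ≤ a_{h_j}} be the smallest submatrix of X containing L_j, where l_j = min{i : x_{b_i,a_i} ∈ L_j} and h_j = max{i : x_{b_i,a_i} ∈ L_j}. Let X' = X_1 ∪ … ∪ X_k and I_t(X') = I_{t_1}(X_1) + … + I_{t_k}(X_k) ⊆ K[X']. Then I_t(X') ∩ K[L] = I_t(L). -/

import Mathlib

open MvPolynomial

/-- The data of a two-sided ladder inside an `m × n` matrix of indeterminates,
with upper outside corners `(b i, a i)` and lower outside corners `(d j, c j)`,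
together with a vector `t` of minor sizes, subject to the standing assumptions. -/
structure LadderData where
  m : ℕ
  n : ℕ
  h : ℕ
  k : ℕ
  hpos : 0 < h
  kpos : 0 < k
  hmn : m ≤ n
  b : Fin h → ℕ
  a : Fin h → ℕ
  d : Fin k → ℕ
  c : Fin k → ℕ
  t : Fin k → ℕ
  b_mono : StrictMono b
  a_mono : StrictMono a
  b_first : b ⟨0, hpos⟩ = 1
  b_le : ∀ i, b i ≤ m
  a_pos : ∀ i, 1 ≤ a i
  a_last : a ⟨h - 1, Nat.sub_lt hpos Nat.one_pos⟩ = n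
  d_mono : Monotone d
  c_mono : Monotone c
  d_pos : ∀ j, 1 ≤ d j
  d_last : d ⟨k - 1, Nat.sub_lt kpos Nat.one_pos⟩ = m
  c_first : c ⟨0, kpos⟩ = 1
  c_le : ∀ j, c j ≤ n
  corners_distinct : ∀ j j' : Fin k, d j = d j' → c j = c j' → j = j'
  t_pos : ∀ j, 1 ≤ t j
  step_d : ∀ (j : ℕ) (hj : j + 1 < k),
    d ⟨j, Nat.lt_of_succ_lt hj⟩ + t ⟨j + 1, hj⟩ < d ⟨j + 1, hj⟩ + t ⟨j, Nat.lt_of_succ_lt hj⟩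
  step_c : ∀ (j : ℕ) (hj : j + 1 < k),
    c ⟨j, Nat.lt_of_succ_lt hj⟩ + t ⟨j, Nat.lt_of_succ_lt hj⟩ < c ⟨j + 1, hj⟩ + t ⟨j + 1, hj⟩

namespace LadderData

/-- The set of positions (row, column) of the indeterminates of the ladder `L`. -/
def L (D : LadderData) : Set (ℕ × ℕ) :=
  {p | ∃ (i : Fin D.h) (j : Fin D.k),
    D.b i ≤ p.1 ∧ p.1 ≤ D.m ∧ 1 ≤ p.2 ∧ p.2 ≤ D.a i ∧
    1 ≤ p.1 ∧ p.1 ≤ D.d j ∧ D.c j ≤ p.2 ∧ p.2 ≤ D.n}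

/-- The one-sided subladder `L_j` with lower outside corner `(d j, c j)`. -/
def Lj (D : LadderData) (j : Fin D.k) : Set (ℕ × ℕ) :=
  {p ∈ D.L | p.1 ≤ D.d j ∧ D.c j ≤ p.2}

end LadderData

/-- The ideal of `K[V]` (`V` a set of positions of indeterminates) generated by the
`s × s` minors of the generic matrix all of whose entries lie in `S`. -/
noncomputable def minorsIdeal (K : Type*) [Field K] (V S : Set (ℕ × ℕ)) (s : ℕ) :
    Ideal (MvPolynomial ↥V K) :=
  Ideal.span {f | ∃ r cc : Fin s → ℕ, StrictMono r ∧ StrictMono cc ∧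
    (∀ p q, (r p, cc q) ∈ S) ∧
    ∃ hmem : ∀ p q, ((r p, cc q) : ℕ × ℕ) ∈ V,
    f = (Matrix.of fun p q =>
      (MvPolynomial.X (⟨(r p, cc q), hmem p q⟩ : V) : MvPolynomial ↥V K)).det}

/-- The mixed ladder determinantal ideal `I_t(L) = I_{t_1}(L_1) + ⋯ + I_{t_k}(L_k) ⊆ K[L]`. -/
noncomputable def LadderData.It (D : LadderData) (K : Type*) [Field K] :
    Ideal (MvPolynomial ↥D.L K) :=
  ⨆ j : Fin D.k, minorsIdeal K D.L (D.Lj j) (D.t j)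

/-- Every entry of the ladder is involved in one of the minors generating `I_t(L)`. -/
def LadderData.Nondeg (D : LadderData) : Prop :=
  ∀ p ∈ D.L, ∃ (j : Fin D.k) (r cc : Fin (D.t j) → ℕ),
    StrictMono r ∧ StrictMono cc ∧ (∀ u v, (r u, cc v) ∈ D.Lj j) ∧ ∃ u v, (r u, cc v) = p

/-! ### Rank conditions on submatrices -/

/-- The submatrix of `M` on the rows `< p` and the columns in `S` factors through `R ^ r`.
Over a field this says that its rank is at most `r`. -/
def RankLE {R ι : Type*} [CommRing R] (M : ℕ → ι → R) (p : ℕ) (S : Set ι) (r : ℕ) : Prop :=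
  ∃ (U : ℕ → Fin r → R) (W : Fin r → ι → R),
    ∀ i < p, ∀ j ∈ S, M i j = ∑ k, U i k * W k j

namespace RankLE

theorem map {R R' ι : Type*} [CommRing R] [CommRing R'] (φ : R →+* R') {M : ℕ → ι → R}
    {p : ℕ} {S : Set ι} {r : ℕ} (h : RankLE M p S r) :
    RankLE (fun i j => φ (M i j)) p S r := by
  obtain ⟨U, W, h⟩ := h
  refine ⟨fun i k => φ (U i k), fun k j => φ (W k j), fun i hi j hj => ?_⟩
  simp [h i hi j hj, map_sum, map_mul]

theorem congr {R ι : Type*} [CommRing R] {M N : ℕ → ι → R}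
    {p : ℕ} {S : Set ι} {r : ℕ} (h : RankLE M p S r)
    (hMN : ∀ i < p, ∀ j ∈ S, N i j = M i j) : RankLE N p S r := by
  obtain ⟨U, W, h⟩ := h
  exact ⟨U, W, fun i hi j hj => by rw [hMN i hi j hj, h i hi j hj]⟩

theorem mono {R ι : Type*} [CommRing R] {M : ℕ → ι → R} {p p' : ℕ} {S S' : Set ι} {r r' : ℕ}
    (h : RankLE M p S r) (hp : p' ≤ p) (hS : S' ⊆ S) (hr : r ≤ r') : RankLE M p' S' r' := by
  obtain ⟨U, W, h⟩ := h
  obtain ⟨s, rfl⟩ := Nat.exists_eq_add_of_le hr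
  refine ⟨fun i => Fin.append (U i) 0, fun k j => Fin.append (fun k => W k j) 0 k,
    fun i hi j hj => ?_⟩
  rw [h i (by omega) j (hS hj), Fin.sum_univ_add]
  simp

theorem det_eq_zero {F ι : Type*} [Field F] {M : ℕ → ι → F} {p : ℕ} {S : Set ι} {r s : ℕ}
    (h : RankLE M p S r) (hs : r < s) (a : Fin s → ℕ) (b : Fin s → ι)
    (ha : ∀ k, a k < p) (hb : ∀ k, b k ∈ S) :
    (Matrix.of fun k l => M (a k) (b l)).det = 0 := by
  obtain ⟨U, W, h⟩ := h
  have key : (Matrix.of fun k l => M (a k) (b l)) =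
      (Matrix.of fun k l => U (a k) l) * (Matrix.of fun k l => W k (b l)) := by
    ext k l
    simp [Matrix.mul_apply, h _ (ha k) _ (hb l)]
  by_contra hdet
  have h1 := Matrix.rank_of_isUnit _ ((Matrix.isUnit_iff_isUnit_det _).2 (isUnit_iff_ne_zero.2 hdet))
  have h2 := Matrix.rank_mul_le_left (Matrix.of fun k l => U (a k) l)
    (Matrix.of fun k l => W k (b l))
  have h3 := Matrix.rank_le_width (Matrix.of fun (k : Fin s) l => U (a k) l)
  rw [← key, h1] at h2
  simp at h2
  omega

/-- If the left factor of a factorization through `F ^ r` has no left inverse, then the matrix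
already factors through `F ^ (r - 1)`. -/
theorem exists_leftInverse_or {F ι : Type*} [Field F] {M : ℕ → ι → F} {p : ℕ} {S : Set ι} {r : ℕ}
    {U : ℕ → Fin r → F} {W : Fin r → ι → F}
    (h : ∀ i < p, ∀ j ∈ S, M i j = ∑ k, U i k * W k j) :
    (∃ s, r = s + 1 ∧ RankLE M p S s) ∨
      ∃ A : Fin r → Fin p → F, ∀ k l, ∑ i : Fin p, A k i * U i l = if k = l then 1 else 0 := by
  by_cases hli : LinearIndependent F (fun k (i : Fin p) => U i k)
  · right
    obtain ⟨g, hg⟩ := LinearMap.exists_leftInverse_of_injective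
      (Matrix.mulVecLin (Matrix.of fun (i : Fin p) k => U i k)) (by
        rw [LinearMap.ker_eq_bot]
        exact Matrix.mulVec_injective_iff.2 hli)
    refine ⟨fun k i => g (Pi.single i 1) k, fun k l => ?_⟩
    have h1 := congrFun (LinearMap.congr_fun hg (Pi.single l 1)) k
    have h2 : (fun i : Fin p => U i l) = ∑ i : Fin p, U i l • (Pi.single i 1 : Fin p → F) := by
      ext x
      simp [Finset.sum_apply, Pi.single_apply]
    have h3 : (Matrix.mulVecLin (Matrix.of fun (i : Fin p) k => U i k)) (Pi.single l 1)
        = fun i : Fin p => U i l := by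
      ext x
      simp
    rw [LinearMap.comp_apply, h3, h2, map_sum] at h1
    simp only [map_smul, Finset.sum_apply, Pi.smul_apply, smul_eq_mul, LinearMap.id_apply,
      Pi.single_apply] at h1
    rw [← h1]
    exact Finset.sum_congr rfl fun i _ => mul_comm _ _
  · left
    obtain ⟨g, hg, k0, hk0⟩ := Fintype.not_linearIndependent_iff.1 hli
    obtain ⟨s, rfl⟩ : ∃ s, r = s + 1 := ⟨r - 1, by have := k0.pos; omega⟩
    refine ⟨s, rfl, fun i k => U i (k0.succAbove k),
      fun k j => W (k0.succAbove k) j - g (k0.succAbove k) / g k0 * W k0 j, fun i hi j hj => ?_⟩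
    have h1 := congrFun hg ⟨i, hi⟩
    simp only [Finset.sum_apply, Pi.smul_apply, smul_eq_mul, Pi.zero_apply] at h1
    rw [Fin.sum_univ_succAbove _ k0] at h1
    rw [h i hi j hj, Fin.sum_univ_succAbove _ k0]
    have h2 : U i k0 = - (∑ k, g (k0.succAbove k) * U i (k0.succAbove k)) / g k0 := by
      rw [eq_div_iff hk0]; linear_combination h1
    rw [h2]
    simp only [mul_sub, Finset.sum_sub_distrib]
    have h3 : ∑ x, U i (k0.succAbove x) * (g (k0.succAbove x) / g k0 * W k0 j) =
        (∑ k, g (k0.succAbove k) * U i (k0.succAbove k)) / g k0 * W k0 j := by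
      rw [Finset.sum_div, Finset.sum_mul]
      exact Finset.sum_congr rfl fun x _ => by ring
    rw [h3]
    ring

/-- Completing a matrix with one missing corner entry: if both the matrix without its last column
and the one without its last row have rank at most `r`, then either the entry can be filled in
without exceeding rank `r`, or the matrix without last row and column has rank less than `r`. -/
theorem exists_completion {F : Type*} [Field F] {M : ℕ → ℕ → F} {p q r : ℕ}
    (h1 : RankLE M p (Set.Iio (q + 1)) r) (h2 : RankLE M (p + 1) (Set.Iio q) r) :
    (∃ s, r = s + 1 ∧ RankLE M p (Set.Iio q) s) ∨
      ∃ y, RankLE (fun i j => if i = p ∧ j = q then y else M i j) (p + 1)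
        (Set.Iio (q + 1)) r := by
  obtain ⟨U, W, h1⟩ := h1
  obtain ⟨U', W', h2⟩ := h2
  have h2' : ∀ i < p, ∀ j ∈ Set.Iio q, M i j = ∑ k, U' i k * W' k j :=
    fun i hi j hj => h2 i (by omega) j hj
  rcases exists_leftInverse_or h2' with h | ⟨A, hA⟩
  · exact Or.inl h
  right
  -- the coefficients expressing `W'` in terms of `W`
  let G : Fin r → Fin r → F := fun k l => ∑ i : Fin p, A k i * U i l
  have hW' : ∀ k, ∀ j < q, W' k j = ∑ l, G k l * W l j := by
    intro k j hj
    have e1 : ∑ i : Fin p, A k i * M i j = W' k j := by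
      calc _ = ∑ i : Fin p, ∑ l, A k i * U' i l * W' l j := by
            refine Finset.sum_congr rfl fun i _ => ?_
            rw [h2' i i.2 j hj, Finset.mul_sum]
            exact Finset.sum_congr rfl fun l _ => by ring
        _ = ∑ l, (∑ i : Fin p, A k i * U' i l) * W' l j := by
            rw [Finset.sum_comm]
            exact Finset.sum_congr rfl fun l _ => by rw [Finset.sum_mul]
        _ = _ := by simp [hA]
    have e2 : ∑ i : Fin p, A k i * M i j = ∑ l, G k l * W l j := by
      calc _ = ∑ i : Fin p, ∑ l, A k i * U i l * W l j := by
            refine Finset.sum_congr rfl fun i _ => ?_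
            rw [h1 i i.2 j (Set.mem_Iio.2 (by omega)), Finset.mul_sum]
            exact Finset.sum_congr rfl fun l _ => by ring
        _ = _ := by
            rw [Finset.sum_comm]
            exact Finset.sum_congr rfl fun l _ => by rw [Finset.sum_mul]
    rw [← e1, e2]
  let z : Fin r → F := fun l => ∑ k, U' p k * G k l
  refine ⟨∑ l, z l * W l q, fun i l => if i = p then z l else U i l, W, fun i hi j hj => ?_⟩
  have hj' : j < q + 1 := hj
  by_cases hip : i = p
  · subst hip
    by_cases hjq : j = q
    · simp [hjq]
    · have hjq' : j < q := by omega
      simp only [hjq, and_false, if_false, if_true]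
      rw [h2 i hi j hjq']
      calc _ = ∑ k, ∑ l, U' i k * G k l * W l j := by
            refine Finset.sum_congr rfl fun k _ => ?_
            rw [hW' k j hjq', Finset.mul_sum]
            exact Finset.sum_congr rfl fun l _ => by ring
        _ = _ := by
            rw [Finset.sum_comm]
            exact Finset.sum_congr rfl fun l _ => by rw [Finset.sum_mul]
  · simp only [hip, false_and, if_false]
    exact h1 i (by omega) j hj

end RankLE

/-- Replace the entry `(p, q)` of `M` by `s⁻¹` and add `s` times the product of the `q`-th column
and the `p`-th row to the entries north-west of it. -/
noncomputable def shear {F : Type*} [Field F] (M : ℕ → ℕ → F) (p q : ℕ) (s : F) : ℕ → ℕ → F :=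
  fun i j => if i = p ∧ j = q then s⁻¹
    else if i < p ∧ j < q then M i j + s * M i q * M p j else M i j

theorem RankLE.shear_corner {F : Type*} [Field F] {M : ℕ → ℕ → F} {p q r : ℕ} {s : F}
    (hs : s ≠ 0) (h : RankLE M p (Set.Iio q) r) :
    RankLE (shear M p q s) (p + 1) (Set.Iio (q + 1)) (r + 1) := by
  obtain ⟨U, W, h⟩ := h
  refine ⟨fun i => Fin.cons (if i = p then 1 else s * M i q) (fun k => if i = p then 0 else U i k),
    Fin.cons (fun j => if j = q then s⁻¹ else M p j) (fun k j => if j = q then 0 else W k j),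
    fun i hi j hj => ?_⟩
  have hj' : j < q + 1 := hj
  rw [Fin.sum_univ_succ]
  simp only [Fin.cons_zero, Fin.cons_succ, shear]
  by_cases hip : i = p <;> by_cases hjq : j = q
  · simp [hip, hjq]
  · simp [hip, hjq]
  · simp only [hip, hjq, if_true, if_false, false_and, and_false, mul_zero, lt_irrefl,
      Finset.sum_const_zero, add_zero]
    field_simp
  · have hi' : i < p := by omega
    have hj'' : j < q := by omega
    simp only [hip, hjq, if_false, hi', hj'', and_self, if_true]
    rw [h i hi' j hj'']
    ring

theorem RankLE.shear_of_le_of_lt {F : Type*} [Field F] {M : ℕ → ℕ → F} {p q r p' q' : ℕ} {s : F}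
    (hp : p' ≤ p) (hq : q < q') (h : RankLE M p' (Set.Iio q') r) :
    RankLE (shear M p q s) p' (Set.Iio q') r := by
  obtain ⟨U, W, h⟩ := h
  refine ⟨U, fun k j => W k j + if j < q then s * W k q * M p j else 0, fun i hi j hj => ?_⟩
  have hip : i ≠ p := by omega
  have hip' : i < p := by omega
  simp only [shear, hip, hip', false_and, if_false, true_and, mul_add, Finset.sum_add_distrib,
    ← h i hi j hj]
  split_ifs
  · rw [h i hi q hq, Finset.mul_sum, Finset.sum_mul]
    congr 1
    exact Finset.sum_congr rfl fun k _ => by ring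
  · simp

theorem RankLE.shear_of_lt_of_le {F : Type*} [Field F] {M : ℕ → ℕ → F} {p q r p' q' : ℕ} {s : F}
    (hp : p < p') (hq : q' ≤ q) (h : RankLE M p' (Set.Iio q') r) :
    RankLE (shear M p q s) p' (Set.Iio q') r := by
  obtain ⟨U, W, h⟩ := h
  refine ⟨fun i k => U i k + if i < p then s * M i q * U p k else 0, W, fun i hi j hj => ?_⟩
  have hj' : j < q' := hj
  have hjq : j ≠ q := by omega
  have hjq' : j < q := by omega
  simp only [shear, hjq, hjq', and_false, if_false, and_true, add_mul, Finset.sum_add_distrib,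
    ← h i hi j hj]
  split_ifs
  · rw [h p hp j hj, Finset.mul_sum]
    congr 1
    exact Finset.sum_congr rfl fun k _ => by ring
  · simp

/-! ### Varieties defined by nested rank conditions are connected by rational curves -/

/-- A matrix of rank at most `r` has a spanning set of `r` columns; adjoining them (or zero
columns) to the matrix preserves rank conditions on larger sets of columns. -/
theorem RankLE.exists_columns {F ι : Type*} [Field F] {M : ℕ → ι → F} {p : ℕ} {S : Set ι} {r : ℕ}
    (h : RankLE M p S r) :
    ∃ (B : ℕ → Fin r → F) (W : Fin r → ι → F),
      (∀ i < p, ∀ j ∈ S, M i j = ∑ k, B i k * W k j) ∧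
      ∀ (p' : ℕ) (S' : Set ι) (r' : ℕ), S ⊆ S' → RankLE M p' S' r' →
        RankLE (fun i => Sum.elim (B i) (M i)) p' (Sum.elim (fun _ => True) (· ∈ S')) r' := by
  classical
  obtain ⟨U, V, hUV⟩ := h
  let col : ι → Fin p → F := fun j i => M i j
  obtain ⟨f, hfS, hfspan, -⟩ := Submodule.exists_fun_fin_finrank_span_eq F (col '' S)
  have hle : Submodule.span F (col '' S) ≤
      Submodule.span F (Set.range fun k (i : Fin p) => U i k) := by
    rw [Submodule.span_le]
    rintro _ ⟨j, hj, rfl⟩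
    have : col j = ∑ k, V k j • (fun i : Fin p => U i k) := by
      ext i
      simp only [col, Finset.sum_apply, Pi.smul_apply, smul_eq_mul]
      rw [hUV i i.2 j hj]
      exact Finset.sum_congr rfl fun k _ => mul_comm _ _
    rw [this]
    exact Submodule.sum_mem _ fun k _ =>
      Submodule.smul_mem _ _ (Submodule.subset_span ⟨k, rfl⟩)
  have hn : Module.finrank F (Submodule.span F (col '' S)) ≤ r := by
    refine (Submodule.finrank_mono hle).trans ?_
    have := finrank_range_le_card (R := F) (fun k (i : Fin p) => U i k)
    simpa [Set.finrank] using this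
  generalize Module.finrank F (Submodule.span F (col '' S)) = n at f hfS hfspan hn
  choose e heS he using hfS
  have hW : ∀ j ∈ S, ∃ w : Fin n → F, ∑ k, w k • f k = col j := by
    intro j hj
    rw [← Submodule.mem_span_range_iff_exists_fun, hfspan]
    exact Submodule.subset_span ⟨j, hj, rfl⟩
  choose! w hw using hW
  refine ⟨fun i k => if hk : k.1 < n then M i (e ⟨k, hk⟩) else 0,
    fun k j => if hk : k.1 < n then w j ⟨k, hk⟩ else 0, fun i hi j hj => ?_, ?_⟩
  · have h1 := congrFun (hw j hj) ⟨i, hi⟩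
    simp only [Finset.sum_apply, Pi.smul_apply, smul_eq_mul, ← he, col] at h1
    rw [← h1]
    obtain ⟨d, rfl⟩ := Nat.exists_eq_add_of_le hn
    rw [Fin.sum_univ_add]
    simp [mul_comm]
  · rintro p' S' r' hSS' ⟨U', V', h'⟩
    refine ⟨U', fun x => Sum.elim (fun k => if hk : k.1 < n then V' x (e ⟨k, hk⟩) else 0)
      (V' x), fun i hi j hj => ?_⟩
    rcases j with k | j
    · simp only [Sum.elim_inl]
      split_ifs with hk
      · exact h' i hi _ (hSS' (heS _))
      · simp
    · exact h' i hi j hj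

open Polynomial in
/-- Two matrices satisfying the same nested rank conditions lie on a polynomial curve of matrices
satisfying these conditions. -/
theorem exists_polynomial_path {F : Type*} [Field F] (p r : ℕ → ℕ) (k : ℕ)
    (hp : ∀ i j, i ≤ j → j < k → p i ≤ p j) {ι : Type} (S : ℕ → Set ι)
    (hS : ∀ i j, i ≤ j → j < k → S j ⊆ S i) (M N : ℕ → ι → F)
    (hM : ∀ j < k, RankLE M (p j) (S j) (r j)) (hN : ∀ j < k, RankLE N (p j) (S j) (r j)) :
    ∃ Γ : ℕ → ι → F[X], (∀ j < k, RankLE Γ (p j) (S j) (r j)) ∧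
      (∀ i l, (Γ i l).eval 0 = M i l) ∧ ∀ i l, (Γ i l).eval 1 = N i l := by
  classical
  induction k generalizing ι with
  | zero =>
    refine ⟨fun i l => Polynomial.C (M i l) + Polynomial.X * Polynomial.C (N i l - M i l),
      fun j hj => absurd hj (Nat.not_lt_zero j), ?_, ?_⟩ <;> simp
  | succ k ih =>
    obtain ⟨B, V, hBV, hB⟩ := (hM k (Nat.lt_succ_self k)).exists_columns
    obtain ⟨B', V', hBV', hB'⟩ := (hN k (Nat.lt_succ_self k)).exists_columns
    obtain ⟨Γ, hΓ, hΓ0, hΓ1⟩ := ih (ι := Fin (r k) ⊕ ι) (fun i j hij hj => hp i j hij (by omega))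
      (fun j => Sum.elim (fun _ => True) (· ∈ S j))
      (fun i j hij hj x hx => by
        rcases x with x | x
        · trivial
        · exact hS i j hij (by omega) hx)
      (fun i => Sum.elim (B i) (M i)) (fun i => Sum.elim (B' i) (N i))
      (fun j hj => hB _ _ _ (hS j k hj.le (by omega)) (hM j (by omega)))
      (fun j hj => hB' _ _ _ (hS j k hj.le (by omega)) (hN j (by omega)))
    let W : Fin (r k) → ι → F[X] := fun x l =>
      Polynomial.C (V x l) + Polynomial.X * Polynomial.C (V' x l - V x l)
    refine ⟨fun i l => if i < p k ∧ l ∈ S k then ∑ x, Γ i (Sum.inl x) * W x l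
      else Γ i (Sum.inr l), fun j hj => ?_, fun i l => ?_, fun i l => ?_⟩
    · rcases Nat.lt_succ_iff_lt_or_eq.1 hj with hj' | rfl
      · obtain ⟨U, Y, hUY⟩ := hΓ j hj'
        refine ⟨U, fun y l => if l ∈ S k then ∑ x, Y y (Sum.inl x) * W x l else Y y (Sum.inr l),
          fun i hi l hl => ?_⟩
        have hik : i < p k := hi.trans_le (hp j k hj'.le (by omega))
        by_cases hlk : l ∈ S k
        · simp only [hik, hlk, and_self, if_true]
          calc _ = ∑ x, ∑ y, U i y * Y y (Sum.inl x) * W x l := by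
                refine Finset.sum_congr rfl fun x _ => ?_
                rw [hUY i hi (Sum.inl x) trivial, Finset.sum_mul]
            _ = _ := by
                rw [Finset.sum_comm]
                refine Finset.sum_congr rfl fun y _ => ?_
                rw [Finset.mul_sum]
                exact Finset.sum_congr rfl fun x _ => by ring
        · simp only [hlk, and_false, if_false]
          exact hUY i hi (Sum.inr l) hl
      · refine ⟨fun i x => Γ i (Sum.inl x), W, fun i hi l hl => ?_⟩
        simp [hi, hl]
    · simp only
      split_ifs with h
      · simp [Polynomial.eval_finsetSum, hΓ0, W, hBV i h.1 l h.2]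
      · simp [hΓ0]
    · simp only
      split_ifs with h
      · simp [Polynomial.eval_finsetSum, hΓ1, W, hBV' i h.1 l h.2]
      · simp [hΓ1]

/-! ### The ideal of a variety defined by rank conditions -/

/-- The matrix `M` satisfies the rank conditions `C`: for `(p, q, r) ∈ C`, the submatrix on the
rows `< p` and columns `< q` has rank at most `r`. -/
def SatisfiesRank {R : Type*} [CommRing R] (C : Finset (ℕ × ℕ × ℕ)) (M : ℕ → ℕ → R) : Prop :=
  ∀ c ∈ C, RankLE M c.1 (Set.Iio c.2.1) c.2.2

universe u

/-- The ideal of polynomials vanishing on all matrices, with entries in a field extension of `K`,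
that satisfy the rank conditions `C`. -/
def rankIdeal (K : Type u) [Field K] (C : Finset (ℕ × ℕ × ℕ)) : Ideal (MvPolynomial (ℕ × ℕ) K) where
  carrier := {f | ∀ (F : Type u) [Field F] [Algebra K F] (M : ℕ → ℕ → F), SatisfiesRank C M →
    aeval (fun x : ℕ × ℕ => M x.1 x.2) f = 0}
  add_mem' hf hg F _ _ M hM := by rw [map_add, hf F M hM, hg F M hM, add_zero]
  zero_mem' F _ _ M _ := map_zero _
  smul_mem' a f hf F _ _ M hM := by rw [smul_eq_mul, map_mul, hf F M hM, mul_zero]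

theorem mem_rankIdeal {K : Type u} [Field K] {C : Finset (ℕ × ℕ × ℕ)}
    {f : MvPolynomial (ℕ × ℕ) K} :
    f ∈ rankIdeal K C ↔ ∀ (F : Type u) [Field F] [Algebra K F] (M : ℕ → ℕ → F),
      SatisfiesRank C M → aeval (fun x : ℕ × ℕ => M x.1 x.2) f = 0 := Iff.rfl

theorem aeval_entries_map {K R R' : Type*} [CommRing K] [CommRing R] [CommRing R'] [Algebra K R]
    [Algebra K R'] (φ : R →ₐ[K] R') (M : ℕ → ℕ → R) (f : MvPolynomial (ℕ × ℕ) K) :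
    aeval (fun x : ℕ × ℕ => φ (M x.1 x.2)) f = φ (aeval (fun x : ℕ × ℕ => M x.1 x.2) f) := by
  rw [← AlgHom.comp_apply, comp_aeval]

open Polynomial TensorProduct in
theorem rankIdeal_isPrime (K : Type u) [Field K] {k : ℕ} (p q r : Fin k → ℕ) (hp : Monotone p)
    (hq : Antitone q) :
    (rankIdeal K (Finset.univ.image fun j => (p j, q j, r j))).IsPrime := by
  set C := Finset.univ.image fun j => (p j, q j, r j)
  have hC : ∀ {R : Type u} [CommRing R] (M : ℕ → ℕ → R), SatisfiesRank C M ↔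
      ∀ j (hj : j < k), RankLE M (p ⟨j, hj⟩) (Set.Iio (q ⟨j, hj⟩)) (r ⟨j, hj⟩) := by
    intro R _ M
    simp only [SatisfiesRank, C, Finset.mem_image, Finset.mem_univ, true_and]
    constructor
    · exact fun h j hj => h _ ⟨⟨j, hj⟩, rfl⟩
    · rintro h _ ⟨j, rfl⟩
      exact h j.1 j.2
  refine ⟨?_, ?_⟩
  · rw [Ne, Ideal.eq_top_iff_one, mem_rankIdeal]
    intro h
    have := h K (fun _ _ => 0) fun c _ => ⟨0, 0, by simp⟩
    simp at this
  · intro f g hfg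
    by_contra! hcon
    obtain ⟨hf, hg⟩ := hcon
    simp only [mem_rankIdeal] at hf hg
    push Not at hf hg
    obtain ⟨F₁, _, _, M₁, hM₁, hf⟩ := hf
    obtain ⟨F₂, _, _, M₂, hM₂, hg⟩ := hg
    -- a common field extension
    obtain ⟨m, hm⟩ := Ideal.exists_maximal (F₁ ⊗[K] F₂)
    let F := (F₁ ⊗[K] F₂) ⧸ m
    let : Field F := Ideal.Quotient.field m
    let φ₁ : F₁ →ₐ[K] F := (Ideal.Quotient.mkₐ K m).comp Algebra.TensorProduct.includeLeft
    let φ₂ : F₂ →ₐ[K] F := (Ideal.Quotient.mkₐ K m).comp Algebra.TensorProduct.includeRight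
    have hf' : aeval (fun x : ℕ × ℕ => φ₁ (M₁ x.1 x.2)) f ≠ 0 := by
      rw [aeval_entries_map]
      exact (map_ne_zero φ₁).2 hf
    have hg' : aeval (fun x : ℕ × ℕ => φ₂ (M₂ x.1 x.2)) g ≠ 0 := by
      rw [aeval_entries_map]
      exact (map_ne_zero φ₂).2 hg
    have ext : ∀ j (hj : j < k), ∀ s : Fin k → ℕ, (if h : j < k then s ⟨j, h⟩ else 0) = s ⟨j, hj⟩ :=
      fun j hj s => dif_pos hj
    obtain ⟨Γ, hΓ, hΓ0, hΓ1⟩ := exists_polynomial_path (F := F)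
      (fun j => if h : j < k then p ⟨j, h⟩ else 0) (fun j => if h : j < k then r ⟨j, h⟩ else 0) k
      (fun i j hij hj => by
        rw [ext j hj, ext i (by omega)]
        exact hp hij)
      (fun j => Set.Iio (if h : j < k then q ⟨j, h⟩ else 0))
      (fun i j hij hj => by
        rw [ext j hj, ext i (by omega)]
        exact Set.Iio_subset_Iio (hq hij))
      (fun i j => φ₁ (M₁ i j)) (fun i j => φ₂ (M₂ i j))
      (fun j hj => by
        rw [ext j hj, ext j hj, ext j hj]
        exact ((hC _).1 hM₁ j hj).map φ₁.toRingHom)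
      (fun j hj => by
        rw [ext j hj, ext j hj, ext j hj]
        exact ((hC _).1 hM₂ j hj).map φ₂.toRingHom)
    have h1 := hfg (RatFunc F) (fun i j => algebraMap F[X] (RatFunc F) (Γ i j)) ((hC _).2
      fun j hj => by
        have := (hΓ j hj).map (algebraMap F[X] (RatFunc F))
        rwa [ext j hj, ext j hj, ext j hj] at this)
    have h2 := aeval_entries_map (IsScalarTower.toAlgHom K F[X] (RatFunc F)) Γ (f * g)
    simp only [IsScalarTower.coe_toAlgHom'] at h2
    rw [h1, eq_comm, map_eq_zero_iff _ (IsFractionRing.injective F[X] (RatFunc F)), map_mul,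
      mul_eq_zero] at h2
    have eval_aeval : ∀ (t : F) (h : MvPolynomial (ℕ × ℕ) K),
        aeval (fun x : ℕ × ℕ => (Γ x.1 x.2).eval t) h =
          (aeval (fun x : ℕ × ℕ => Γ x.1 x.2) h).eval t := fun t h => by
      have := aeval_entries_map ((Polynomial.aeval (R := F) t).restrictScalars K) Γ h
      simpa [Polynomial.aeval_def, Polynomial.eval₂_eq_eval_map] using this
    rcases h2 with h2 | h2
    · apply hf'
      have := eval_aeval 0 f
      simpa only [h2, hΓ0, Polynomial.eval_zero] using this
    · apply hg'
      have := eval_aeval 1 g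
      simpa only [h2, hΓ1, Polynomial.eval_zero] using this

/-! ### Linear independence of the standard monomials -/

/-- A monomial is standard for the rank conditions `C` if for no `(p, q, r) ∈ C` it is divisible by
the main diagonal of an `(r + 1)`-minor on the rows `< p` and columns `< q`. -/
def IsStandard (C : Finset (ℕ × ℕ × ℕ)) (u : ℕ × ℕ →₀ ℕ) : Prop :=
  ∀ c ∈ C, ∀ s, s = c.2.2 + 1 → ∀ a b : Fin s → ℕ, StrictMono a → StrictMono b →
    (∀ k, a k < c.1) → (∀ k, b k < c.2.1) → ∃ k, u (a k, b k) = 0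

theorem IsStandard.mono {C D : Finset (ℕ × ℕ × ℕ)} {u : ℕ × ℕ →₀ ℕ} (h : IsStandard C u)
    (hDC : ∀ c ∈ D, c ∈ C) : IsStandard D u :=
  fun c hc => h c (hDC c hc)

theorem IsStandard.insert_of_mem {C D : Finset (ℕ × ℕ × ℕ)} {u : ℕ × ℕ →₀ ℕ}
    (h : IsStandard D u) (hC : IsStandard C u) {p q r p' q' : ℕ} (hc : (p, q, r) ∈ C)
    (hp : p' ≤ p) (hq : q' ≤ q) : IsStandard (insert (p', q', r) D) u := by
  intro c hcD s hs a b ha hb hac hbc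
  rcases Finset.mem_insert.1 hcD with rfl | hcD
  · exact hC _ hc s hs a b ha hb (fun k => (hac k).trans_le hp) (fun k => (hbc k).trans_le hq)
  · exact h c hcD s hs a b ha hb hac hbc

theorem strictMono_snoc {n : ℕ} {a : Fin n → ℕ} {p : ℕ} (ha : StrictMono a)
    (hp : ∀ k, a k < p) : StrictMono (Fin.snoc (α := fun _ => ℕ) a p) := by
  intro x y hxy
  induction y using Fin.lastCases with
  | last =>
    obtain ⟨x, rfl⟩ := Fin.exists_castSucc_eq.2 hxy.ne
    simpa using hp x
  | cast y =>
    obtain ⟨x, rfl⟩ := Fin.exists_castSucc_eq.2 (hxy.trans (Fin.castSucc_lt_last y)).ne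
    simpa using ha (Fin.castSucc_lt_castSucc_iff.1 hxy)

theorem IsStandard.insert_pred {C D : Finset (ℕ × ℕ × ℕ)} {u : ℕ × ℕ →₀ ℕ}
    (h : IsStandard D u) (hC : IsStandard C u) {p q r : ℕ} (hc : (p + 1, q + 1, r + 1) ∈ C)
    (hu : u (p, q) ≠ 0) : IsStandard (insert (p, q, r) D) u := by
  intro c hcD s hs a b ha hb hac hbc
  rcases Finset.mem_insert.1 hcD with rfl | hcD
  · obtain ⟨k, hk⟩ := hC _ hc (s + 1) (congrArg (· + 1) hs) _ _ (strictMono_snoc ha hac)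
      (strictMono_snoc hb hbc)
      (fun k => by
        induction k using Fin.lastCases with
        | last => simp
        | cast k => simpa using (hac k).trans (Nat.lt_succ_self p))
      (fun k => by
        induction k using Fin.lastCases with
        | last => simp
        | cast k => simpa using (hbc k).trans (Nat.lt_succ_self q))
    induction k using Fin.lastCases with
    | last => exact absurd (by simpa using hk) hu
    | cast k => exact ⟨k, by simpa using hk⟩
  · exact h c hcD s hs a b ha hb hac hbc

theorem aeval_eq_sum_coeff_mul_prod {σ K R : Type*} [CommRing K] [CommRing R] [Algebra K R]
    (x : σ → R) (f : MvPolynomial σ K) :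
    aeval x f = ∑ u ∈ f.support, algebraMap K R (coeff u f) * u.prod fun v e => x v ^ e := by
  rw [aeval_def, eval₂_eq]
  rfl

open Polynomial in
/-- If a polynomial vanishes at a point over `F(T)` whose `y`-coordinate is `T⁻¹` and whose other
coordinates are polynomials in `T`, then its leading form in `y` vanishes at `T = 0`. -/
theorem aeval_leadingForm_eq_zero {σ : Type*} {K F : Type u} [Field K] [Field F] [Algebra K F]
    (f : MvPolynomial σ K) (y : σ) (d : ℕ) (hd : ∀ u ∈ f.support, u y ≤ d) (G : σ → F[X])
    (N : σ → RatFunc F) (hN : ∀ v, v ≠ y → N v = algebraMap F[X] (RatFunc F) (G v))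
    (hNy : N y = (algebraMap F[X] (RatFunc F) Polynomial.X)⁻¹)
    (hf : MvPolynomial.aeval N f = 0) :
    ∑ u ∈ f.support with u y = d, algebraMap K F (MvPolynomial.coeff u f) *
      u.prod (fun v e => (G v).eval 0 ^ e) = 0 := by
  have hX : algebraMap F[X] (RatFunc F) Polynomial.X ≠ 0 :=
    RatFunc.algebraMap_ne_zero Polynomial.X_ne_zero
  have h1 : algebraMap F[X] (RatFunc F) (∑ u ∈ f.support,
      algebraMap K F[X] (MvPolynomial.coeff u f) * (Polynomial.X ^ (d - u y) *
        (u.erase y).prod fun v e => G v ^ e)) = 0 := by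
    rw [aeval_eq_sum_coeff_mul_prod] at hf
    rw [map_sum, ← mul_zero (algebraMap F[X] (RatFunc F) Polynomial.X ^ d), ← hf, Finset.mul_sum]
    refine Finset.sum_congr rfl fun u hu => ?_
    rw [← Finsupp.mul_prod_erase' u y (fun v e => N v ^ e) (fun i => pow_zero _), hNy, map_mul,
      map_mul, map_pow, ← IsScalarTower.algebraMap_apply]
    have h2 : algebraMap F[X] (RatFunc F) ((u.erase y).prod fun v e => G v ^ e) =
        (u.erase y).prod fun v e => N v ^ e := by
      rw [Finsupp.prod, Finsupp.prod, map_prod]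
      refine Finset.prod_congr rfl fun v hv => ?_
      rw [map_pow, hN v]
      rintro rfl
      simp at hv
    rw [h2]
    obtain ⟨e, rfl⟩ := Nat.exists_eq_add_of_le (hd u hu)
    rw [Nat.add_sub_cancel_left, pow_add, inv_pow]
    field_simp
  rw [map_eq_zero_iff _ (IsFractionRing.injective F[X] (RatFunc F))] at h1
  have h3 := congrArg (Polynomial.eval 0) h1
  rw [Polynomial.eval_finsetSum, Polynomial.eval_zero] at h3
  have h4 : ∀ u ∈ f.support, u y ≠ d → Polynomial.eval 0
      (algebraMap K F[X] (MvPolynomial.coeff u f) * (Polynomial.X ^ (d - u y) *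
        (u.erase y).prod fun v e => G v ^ e)) = 0 := by
    intro u hu hne
    have : d - u y ≠ 0 := by have := hd u hu; omega
    simp [this]
  rw [← Finset.sum_filter_add_sum_filter_not f.support (fun u => u y = d),
    Finset.sum_eq_zero (s := f.support.filter fun u => ¬ u y = d)
      (fun u hu => h4 u (Finset.mem_filter.1 hu).1 (Finset.mem_filter.1 hu).2), add_zero] at h3
  refine Eq.trans ?_ ((congrArg ((G y).eval 0 ^ d * ·) h3).trans (mul_zero _))
  rw [Finset.mul_sum]
  refine Finset.sum_congr rfl fun u hu => ?_
  have hud := (Finset.mem_filter.1 hu).2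
  rw [← Finsupp.mul_prod_erase' u y (fun v e => (G v).eval 0 ^ e) (fun i => pow_zero _), hud]
  have h5 : Polynomial.eval 0 ((u.erase y).prod fun v e => G v ^ e) =
      (u.erase y).prod fun v e => (G v).eval 0 ^ e := by
    simp [Finsupp.prod, Polynomial.eval_prod]
  rw [Polynomial.eval_mul, Polynomial.eval_mul, h5]
  simp only [Nat.sub_self, pow_zero, Polynomial.eval_one, one_mul]
  rw [Polynomial.algebraMap_apply, Polynomial.eval_C]
  ring

open Polynomial in
/-- If `f` vanishes on the variety defined by `insert (p + 1, q + 1, r + 1) C`, then its leading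
form in the `(p, q)`-th indeterminate vanishes on the one defined by `insert (p, q, r) C`. -/
theorem aeval_leadingForm_eq_zero_of_mem_rankIdeal {K F : Type u} [Field K] [Field F] [Algebra K F]
    {C D : Finset (ℕ × ℕ × ℕ)} {p q r : ℕ} {f : MvPolynomial (ℕ × ℕ) K} (hf : f ∈ rankIdeal K D)
    (hD : ∀ c ∈ D, c ∈ C ∨ c.1 ≤ p + 1 ∧ c.2.1 ≤ q + 1 ∧ r + 1 ≤ c.2.2)
    (hC : ∀ c ∈ C, c.1 ≤ p ∧ q < c.2.1 ∨ p < c.1 ∧ c.2.1 ≤ q)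
    {d : ℕ} (hd : ∀ u ∈ f.support, u (p, q) ≤ d)
    {M : ℕ → ℕ → F} (hM : SatisfiesRank C M) (hMr : RankLE M p (Set.Iio q) r) :
    ∑ u ∈ f.support with u (p, q) = d, algebraMap K F (MvPolynomial.coeff u f) *
      u.prod (fun v e => M v.1 v.2 ^ e) = 0 := by
  classical
  let φ : F →+* RatFunc F := algebraMap F (RatFunc F)
  let T : RatFunc F := algebraMap F[X] (RatFunc F) Polynomial.X
  have hT : T ≠ 0 := RatFunc.algebraMap_ne_zero Polynomial.X_ne_zero
  let N := shear (fun i j => φ (M i j)) p q T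
  have hN : SatisfiesRank D N := by
    intro c hc
    rcases hD c hc with hc | ⟨h1, h2, h3⟩
    · rcases hC c hc with ⟨h1, h2⟩ | ⟨h1, h2⟩
      · exact ((hM c hc).map φ).shear_of_le_of_lt h1 h2
      · exact ((hM c hc).map φ).shear_of_lt_of_le h1 h2
    · exact ((hMr.map φ).shear_corner hT).mono h1 (Set.Iio_subset_Iio h2) h3
  let G : ℕ × ℕ → F[X] := fun v => if v.1 < p ∧ v.2 < q then
    Polynomial.C (M v.1 v.2) + Polynomial.X * Polynomial.C (M v.1 q) * Polynomial.C (M p v.2)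
    else Polynomial.C (M v.1 v.2)
  have hG : ∀ v, (G v).eval 0 = M v.1 v.2 := by
    intro v
    simp only [G]
    split_ifs <;> simp
  have hφ : ∀ x, φ x = algebraMap F[X] (RatFunc F) (Polynomial.C x) := fun x => rfl
  have key := aeval_leadingForm_eq_zero f (p, q) d hd G (fun v => N v.1 v.2)
    (fun v hv => by
      have hv' : ¬ (v.1 = p ∧ v.2 = q) := fun h => hv (Prod.ext h.1 h.2)
      simp only [N, shear, hv', if_false, G]
      split_ifs
      · simp only [hφ, T, map_add, map_mul]
      · rw [hφ])
    (by simp [N, shear, T]) (hf _ N hN)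
  simpa only [hG] using key

theorem SatisfiesRank.update {F : Type*} [Field F] {C : Finset (ℕ × ℕ × ℕ)} {p q : ℕ}
    (hC : ∀ c ∈ C, c.1 ≤ p ∧ q < c.2.1 ∨ p < c.1 ∧ c.2.1 ≤ q) {M : ℕ → ℕ → F}
    (hM : SatisfiesRank C M) (y : F) :
    SatisfiesRank C (fun i j => if i = p ∧ j = q then y else M i j) := by
  intro c hc
  refine (hM c hc).congr fun i hi j hj => if_neg ?_
  rintro ⟨rfl, rfl⟩
  have hj' : j < c.2.1 := hj
  rcases hC c hc with h | h <;> omega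

theorem eq_zero_of_mem_rankIdeal_empty {K : Type u} [Field K] {f : MvPolynomial (ℕ × ℕ) K}
    (hf : f ∈ rankIdeal K ∅) : f = 0 := by
  let E := FractionRing (MvPolynomial (ℕ × ℕ) K)
  have h := hf E (fun i j => algebraMap (MvPolynomial (ℕ × ℕ) K) E (X (i, j)))
    (fun c hc => absurd hc (Finset.notMem_empty c))
  have h2 := aeval_entries_map (IsScalarTower.toAlgHom K (MvPolynomial (ℕ × ℕ) K) E)
    (fun i j => X (i, j)) f
  simp only [IsScalarTower.coe_toAlgHom'] at h2
  rw [h, eq_comm, map_eq_zero_iff _ (IsFractionRing.injective _ E)] at h2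
  simpa using h2

set_option maxHeartbeats 1000000 in
/-- Standard monomials are linearly independent modulo the vanishing ideal of the rank
conditions. -/
theorem eq_zero_of_mem_rankIdeal_of_isStandard {K : Type u} [Field K] (C : Finset (ℕ × ℕ × ℕ))
    (hC : ∀ c ∈ C, ∀ c' ∈ C, c.1 ≤ c'.1 ∧ c'.2.1 ≤ c.2.1 ∨ c'.1 ≤ c.1 ∧ c.2.1 ≤ c'.2.1)
    (f : MvPolynomial (ℕ × ℕ) K) (hf : f ∈ rankIdeal K C)
    (hstd : ∀ u ∈ f.support, IsStandard C u) : f = 0 := by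
  classical
  induction hn : ∑ c ∈ C, 3 ^ (c.1 + c.2.1) using Nat.strong_induction_on generalizing C f with
  | _ n ih =>
  subst hn
  rcases C.eq_empty_or_nonempty with rfl | hne
  · exact eq_zero_of_mem_rankIdeal_empty hf
  obtain ⟨c, hc, hmax⟩ := C.exists_max_image
    (fun c => toLex (c.1, toLex (c.2.1, OrderDual.toDual c.2.2))) hne
  obtain ⟨P, Q, r⟩ := c
  replace hmax : ∀ c ∈ C, c.1 < P ∨ c.1 = P ∧ (c.2.1 < Q ∨ c.2.1 = Q ∧ r ≤ c.2.2) := by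
    intro c' hc'
    have := hmax c' hc'
    simpa [Prod.Lex.toLex_le_toLex] using this
  rcases Nat.eq_zero_or_pos P with rfl | hP
  · refine ih _ ?_ (C.erase (0, Q, r))
      (fun c hc c' hc' => hC c (Finset.mem_of_mem_erase hc) c' (Finset.mem_of_mem_erase hc')) f
      (fun F _ _ M hM => hf F M fun c' hc' => ?_)
      (fun u hu c hc => hstd u hu c (Finset.mem_of_mem_erase hc)) rfl
    · exact Finset.sum_erase_lt_of_pos hc (by positivity)
    · by_cases h : c' = (0, Q, r)
      · subst h
        exact ⟨0, 0, fun i hi => absurd hi (Nat.not_lt_zero i)⟩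
      · exact hM c' (Finset.mem_erase.2 ⟨h, hc'⟩)
  rcases Nat.eq_zero_or_pos Q with rfl | hQ
  · refine ih _ ?_ (C.erase (P, 0, r))
      (fun c hc c' hc' => hC c (Finset.mem_of_mem_erase hc) c' (Finset.mem_of_mem_erase hc')) f
      (fun F _ _ M hM => hf F M fun c' hc' => ?_)
      (fun u hu c hc => hstd u hu c (Finset.mem_of_mem_erase hc)) rfl
    · exact Finset.sum_erase_lt_of_pos hc (by positivity)
    · by_cases h : c' = (P, 0, r)
      · subst h
        exact ⟨0, 0, fun i _ j hj => absurd hj (Nat.not_lt_zero j)⟩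
      · exact hM c' (Finset.mem_erase.2 ⟨h, hc'⟩)
  obtain ⟨p, rfl⟩ : ∃ p, P = p + 1 := ⟨P - 1, by omega⟩
  obtain ⟨q, rfl⟩ : ∃ q, Q = q + 1 := ⟨Q - 1, by omega⟩
  -- the conditions at the other corners
  let C₀ := C.filter fun c => ¬ (c.1 = p + 1 ∧ c.2.1 = q + 1)
  have hC₀C : ∀ c ∈ C₀, c ∈ C := fun c hc => (Finset.mem_filter.1 hc).1
  have hC₀ : ∀ c ∈ C₀, c.1 ≤ p ∧ q < c.2.1 ∨ p < c.1 ∧ c.2.1 ≤ q := by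
    intro c' hc'
    have h1 := (Finset.mem_filter.1 hc').2
    have h2 := hmax c' (hC₀C c' hc')
    have h3 := hC c' (hC₀C c' hc') _ hc
    simp only at h3
    omega
  have hC₀' : ∀ c ∈ C₀, c.1 ≤ p + 1 := by
    intro c' hc'
    have h2 := hmax c' (hC₀C c' hc')
    omega
  have hCC₀ : ∀ c ∈ C, c ∈ C₀ ∨ c.1 = p + 1 ∧ c.2.1 = q + 1 ∧ r ≤ c.2.2 := by
    intro c' hc'
    by_cases h : c'.1 = p + 1 ∧ c'.2.1 = q + 1
    · have h2 := hmax c' hc'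
      exact Or.inr ⟨h.1, h.2, by omega⟩
    · exact Or.inl (Finset.mem_filter.2 ⟨hc', h⟩)
  have hsum : ∑ c ∈ C₀, 3 ^ (c.1 + c.2.1) + 3 ^ (p + 1 + (q + 1)) ≤ ∑ c ∈ C, 3 ^ (c.1 + c.2.1) := by
    have h1 : (p + 1, q + 1, r) ∉ C₀ := by simp [C₀]
    have h2 : insert (p + 1, q + 1, r) C₀ ⊆ C :=
      Finset.insert_subset hc (Finset.filter_subset _ _)
    have h3 := Finset.sum_le_sum_of_subset (f := fun c : ℕ × ℕ × ℕ => 3 ^ (c.1 + c.2.1)) h2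
    rw [Finset.sum_insert h1] at h3
    simp only at h3
    omega
  have hinsert : ∀ (c : ℕ × ℕ × ℕ) (D : Finset (ℕ × ℕ × ℕ)),
      ∑ c ∈ insert c D, 3 ^ (c.1 + c.2.1) ≤ 3 ^ (c.1 + c.2.1) + ∑ c ∈ D, 3 ^ (c.1 + c.2.1) := by
    intro c D
    by_cases h : c ∈ D
    · rw [Finset.insert_eq_of_mem h]
      exact Nat.le_add_left _ _
    · rw [Finset.sum_insert h]
  let d := f.support.sup fun u => u (p, q)
  have hd : ∀ u ∈ f.support, u (p, q) ≤ d := fun u hu =>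
    Finset.le_sup (f := fun u : ℕ × ℕ →₀ ℕ => u (p, q)) hu
  rcases Nat.eq_zero_or_pos d with hd0 | hdpos
  · -- `f` does not involve the corner entry, so the corner can be removed from the region
    have hu0 : ∀ u ∈ f.support, u (p, q) = 0 := fun u hu => by
      have := hd u hu
      omega
    refine ih _ ?_ (insert (p, q + 1, r) (insert (p + 1, q, r) C₀)) ?_ f ?_ ?_ rfl
    · have h1 := hinsert (p, q + 1, r) (insert (p + 1, q, r) C₀)
      have h2 := hinsert (p + 1, q, r) C₀
      have h3 : 3 ^ (p + (q + 1)) = 3 ^ (p + q) * 3 := pow_succ 3 (p + q)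
      have h4 : 3 ^ (p + 1 + q) = 3 ^ (p + q) * 3 := by rw [← pow_succ]; congr 1; omega
      have h5 : 3 ^ (p + 1 + (q + 1)) = 3 ^ (p + q) * 9 := by
        rw [show p + 1 + (q + 1) = p + q + 2 by omega, pow_add]; rfl
      have h6 : 0 < 3 ^ (p + q) := by positivity
      simp only at h1 h2
      omega
    · intro c₁ hc₁ c₂ hc₂
      simp only [Finset.mem_insert] at hc₁ hc₂
      rcases hc₁ with rfl | rfl | hc₁ <;> rcases hc₂ with rfl | rfl | hc₂
      any_goals (simp only; omega)
      · have h1 := hC₀ c₂ hc₂; have h2 := hC₀' c₂ hc₂; simp only; omega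
      · have h1 := hC₀ c₂ hc₂; have h2 := hC₀' c₂ hc₂; simp only; omega
      · have h1 := hC₀ c₁ hc₁; have h2 := hC₀' c₁ hc₁; simp only; omega
      · have h1 := hC₀ c₁ hc₁; have h2 := hC₀' c₁ hc₁; simp only; omega
      · exact hC c₁ (hC₀C _ hc₁) c₂ (hC₀C _ hc₂)
    · intro F _ _ M hM
      have hM₀ : SatisfiesRank C₀ M := fun c hc => hM c (by simp [hc])
      rcases RankLE.exists_completion (hM (p, q + 1, r) (by simp)) (hM (p + 1, q, r) (by simp))
        with ⟨s, rfl, hs⟩ | ⟨y, hy⟩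
      · have key := aeval_leadingForm_eq_zero_of_mem_rankIdeal hf
          (fun c hc => (hCC₀ c hc).imp_right fun h => ⟨h.1.le, h.2.1.le, h.2.2⟩) hC₀ hd hM₀ hs
        rw [Finset.filter_true_of_mem fun u hu => (hu0 u hu).trans hd0.symm] at key
        rw [aeval_eq_sum_coeff_mul_prod]
        exact key
      · have key := hf F (fun i j => if i = p ∧ j = q then y else M i j) (fun c hc => by
          rcases hCC₀ c hc with h | ⟨h1, h2, h3⟩
          · exact hM₀.update hC₀ y c h
          · rw [h1, h2]
            exact hy.mono le_rfl subset_rfl h3)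
        rw [← key, aeval_eq_sum_coeff_mul_prod, aeval_eq_sum_coeff_mul_prod]
        refine Finset.sum_congr rfl fun u hu => ?_
        congr 1
        refine Finset.prod_congr rfl fun v hv => ?_
        have hv' : ¬ (v.1 = p ∧ v.2 = q) := by
          rintro ⟨h1, h2⟩
          exact Finsupp.mem_support_iff.1 hv (by rw [← hu0 u hu, ← h1, ← h2])
        simp only [hv', if_false]
    · exact fun u hu => (((hstd u hu).mono hC₀C).insert_of_mem (hstd u hu) hc le_rfl
        (Nat.le_succ q)).insert_of_mem (hstd u hu) hc (Nat.le_succ p) le_rfl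
  · -- the leading form of `f` in the corner entry is standard for fewer rank conditions
    obtain ⟨w, hw, hwd⟩ : ∃ w ∈ f.support, w (p, q) = d := by
      have hne : f.support.Nonempty := by
        by_contra h
        rw [Finset.not_nonempty_iff_eq_empty] at h
        simp [d, h] at hdpos
      obtain ⟨w, hw, h⟩ := f.support.exists_mem_eq_sup hne fun u => u (p, q)
      exact ⟨w, hw, h.symm⟩
    obtain ⟨s, rfl⟩ : ∃ s, r = s + 1 := by
      rcases Nat.eq_zero_or_pos r with rfl | hr
      · obtain ⟨k, hk⟩ := hstd w hw _ hc 1 rfl (fun _ => p) (fun _ => q)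
          (Subsingleton.strictMono _) (Subsingleton.strictMono _) (fun _ => Nat.lt_succ_self p)
          (fun _ => Nat.lt_succ_self q)
        omega
      · exact ⟨r - 1, by omega⟩
    let g : MvPolynomial (ℕ × ℕ) K :=
      ∑ u ∈ f.support with u (p, q) = d, monomial u (coeff u f)
    have hg : ∀ u, coeff u g = if u (p, q) = d then coeff u f else 0 := by
      intro u
      simp only [g, coeff_sum, coeff_monomial]
      rw [Finset.sum_ite_eq' (Finset.filter _ _) u]
      simp only [Finset.mem_filter, mem_support_iff]
      split_ifs <;> simp_all
    have hgsupp : ∀ u ∈ g.support, u ∈ f.support ∧ u (p, q) = d := by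
      intro u hu
      rw [mem_support_iff, hg] at hu
      split_ifs at hu with h
      · exact ⟨mem_support_iff.2 hu, h⟩
      · exact absurd rfl hu
    have hg0 : g = 0 := by
      refine ih _ ?_ (insert (p, q, s) C₀) ?_ g ?_ ?_ rfl
      · have h1 := hinsert (p, q, s) C₀
        have h5 : 3 ^ (p + 1 + (q + 1)) = 3 ^ (p + q) * 9 := by
          rw [show p + 1 + (q + 1) = p + q + 2 by omega, pow_add]; rfl
        have h6 : 0 < 3 ^ (p + q) := by positivity
        simp only at h1
        omega
      · intro c₁ hc₁ c₂ hc₂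
        simp only [Finset.mem_insert] at hc₁ hc₂
        rcases hc₁ with rfl | hc₁ <;> rcases hc₂ with rfl | hc₂
        any_goals (simp only; omega)
        · have h1 := hC₀ c₂ hc₂; simp only; omega
        · have h1 := hC₀ c₁ hc₁; simp only; omega
        · exact hC c₁ (hC₀C _ hc₁) c₂ (hC₀C _ hc₂)
      · intro F _ _ M hM
        have key := aeval_leadingForm_eq_zero_of_mem_rankIdeal hf
          (fun c hc => (hCC₀ c hc).imp_right fun h => ⟨h.1.le, h.2.1.le, h.2.2⟩) hC₀ hd
          (fun c hc => hM c (by simp [hc])) (hM (p, q, s) (by simp))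
        rw [map_sum]
        simpa only [aeval_monomial] using key
      · intro u hu
        obtain ⟨huf, hud⟩ := hgsupp u hu
        exact ((hstd u huf).mono hC₀C).insert_pred (hstd u huf) hc (by omega)
    have h1 := hg w
    rw [hg0, if_pos hwd, coeff_zero] at h1
    exact absurd h1.symm (mem_support_iff.1 hw)

/-! ### Straightening modulo the minors -/

/-- A permutation of `Fin s` that makes a strictly increasing sequence decreasing is `Fin.rev`. -/
theorem eq_revPerm_of_antitone {s : ℕ} {r : Fin s → ℕ} (hr : StrictMono r)
    {σ : Equiv.Perm (Fin s)} (h : Antitone (r ∘ σ)) : σ = Fin.revPerm := by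
  have h1 : StrictMono (σ ∘ Fin.rev) := by
    intro i j hij
    have h2 : r (σ i.rev) ≤ r (σ j.rev) := h (Fin.rev_le_rev.2 hij.le)
    refine lt_of_le_of_ne (hr.le_iff_le.1 h2) fun h3 => hij.ne ?_
    exact Fin.rev_injective (σ.injective h3)
  have h2 : σ ∘ Fin.rev = id := by
    refine (h1.range_inj strictMono_id).1 ?_
    rw [(σ.surjective.comp Fin.rev_surjective).range_eq, Set.range_id]
  ext i
  have := congrFun h2 i.rev
  simp only [Function.comp_apply, Fin.rev_rev, id] at this
  rw [this, Fin.revPerm_apply]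

theorem sum_mul_lt_sum_mul_rev {s n : ℕ} {r cc : Fin s → ℕ} (hr : StrictMono r)
    (hcc : StrictMono cc) (hn : ∀ k, cc k ≤ n) {σ : Equiv.Perm (Fin s)} (hσ : σ ≠ Fin.revPerm) :
    ∑ k, r (σ k) * (n - cc k) < ∑ k, r k.rev * (n - cc k) := by
  have hf : StrictAnti fun k => n - cc k := by
    intro i j hij
    have := hcc hij
    have := hn j
    simp only
    omega
  have hg : Antitone (r ∘ Fin.rev) := fun i j hij => hr.monotone (Fin.rev_le_rev.2 hij)
  have key := (hf.antitone.monovary hg).sum_mul_comp_perm_lt_sum_mul_iff (σ := σ.trans Fin.revPerm)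
  simp only [Function.comp_apply, Equiv.trans_apply, Fin.revPerm_apply, Fin.rev_rev] at key
  simp only [mul_comm (r _)]
  refine key.2 fun hmono => hσ (eq_revPerm_of_antitone hr fun i j hij => ?_)
  rcases hij.eq_or_lt with rfl | hij
  · exact le_rfl
  · by_contra hlt
    have h1 := hmono (i := i) (j := j) (by simpa using hlt)
    exact absurd (hf hij) (not_lt.2 h1)

/-- The weight of a monomial for which the main skew-diagonal term of a minor dominates. -/
noncomputable def skewWeight {V : Set (ℕ × ℕ)} (n : ℕ) : (↥V →₀ ℕ) →+ ℕ :=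
  Finsupp.liftAddHom fun v => AddMonoidHom.mulRight (v.1.1 * (n - v.1.2))

theorem skewWeight_single {V : Set (ℕ × ℕ)} (n : ℕ) (v : ↥V) :
    skewWeight n (Finsupp.single v 1) = v.1.1 * (n - v.1.2) := by
  simp [skewWeight]

/-- Modulo a minor, a monomial divisible by its skew-diagonal is a combination of monomials of
smaller weight. -/
theorem monomial_mem_sup_span_of_skewDiagonal {K : Type*} [Field K] {V : Set (ℕ × ℕ)} {n s : ℕ}
    {r cc : Fin s → ℕ} (hr : StrictMono r) (hcc : StrictMono cc) (hn : ∀ k, cc k ≤ n)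
    (hmem : ∀ k l, (r k, cc l) ∈ V) {I : Ideal (MvPolynomial ↥V K)}
    (hI : (Matrix.of fun k l => (X (⟨(r k, cc l), hmem k l⟩ : ↥V) : MvPolynomial ↥V K)).det ∈ I)
    {u : ↥V →₀ ℕ} (hu : ∀ k, u ⟨(r k, cc k.rev), hmem k k.rev⟩ ≠ 0) :
    (monomial u 1 : MvPolynomial ↥V K) ∈ I.restrictScalars K ⊔
      Submodule.span K {f | ∃ w, skewWeight n w < skewWeight n u ∧ f = monomial w 1} := by
  classical
  let e : Equiv.Perm (Fin s) → ↥V →₀ ℕ := fun σ =>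
    ∑ k, Finsupp.single ⟨(r (σ k), cc k), hmem (σ k) k⟩ 1
  have he : ∀ σ, ∏ k, (X (⟨(r (σ k), cc k), hmem (σ k) k⟩ : ↥V) : MvPolynomial ↥V K) =
      monomial (e σ) 1 := by
    intro σ
    simp only [e, monomial_sum_one]
    rfl
  have hwt : ∀ σ, skewWeight n (e σ) = ∑ k, r (σ k) * (n - cc k) := by
    intro σ
    simp only [e, map_sum, skewWeight_single]
  have hle : e Fin.revPerm ≤ u := by
    intro v
    simp only [e, Finsupp.coe_finsetSum, Finset.sum_apply, Finsupp.single_apply]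
    rw [Finset.sum_boole]
    by_cases hv : ∃ k : Fin s, (⟨(r (Fin.revPerm k), cc k), hmem (Fin.revPerm k) k⟩ : ↥V) = v
    · obtain ⟨k, rfl⟩ := hv
      have h1 : (Finset.univ.filter fun x : Fin s =>
          (⟨(r (Fin.revPerm x), cc x), hmem (Fin.revPerm x) x⟩ : ↥V) =
            ⟨(r (Fin.revPerm k), cc k), hmem (Fin.revPerm k) k⟩) ⊆ {k} := by
        intro x hx
        have := (Finset.mem_filter.1 hx).2
        simp only [Subtype.mk.injEq, Prod.mk.injEq] at this
        exact Finset.mem_singleton.2 (hcc.injective this.2)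
      have h2 := Finset.card_le_card h1
      have h3 := hu k.rev
      simp only [Fin.rev_rev] at h3
      simp only [Finset.card_singleton, Fin.revPerm_apply, Nat.cast_id] at h2 ⊢
      omega
    · push Not at hv
      rw [Finset.filter_false_of_mem fun k _ => hv k]
      simp
  obtain ⟨u', rfl⟩ := exists_add_of_le hle
  have hdet := hI
  rw [Matrix.det_apply] at hdet
  simp only [Matrix.of_apply, he] at hdet
  rw [← Finset.add_sum_erase _ _ (Finset.mem_univ Fin.revPerm)] at hdet
  have hdet2 := I.mul_mem_left (monomial u' 1) hdet
  rw [mul_add, Finset.mul_sum] at hdet2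
  have hsgn : ∀ σ : Equiv.Perm (Fin s), (monomial u' 1 : MvPolynomial ↥V K) *
      (Equiv.Perm.sign σ • monomial (e σ) 1) =
        ((Equiv.Perm.sign σ : ℤ) : K) • monomial (e σ + u') 1 := by
    intro σ
    rw [add_comm, ← one_mul (1 : K), ← monomial_mul, one_mul, Units.smul_def, mul_smul_comm,
      Int.cast_smul_eq_zsmul]
  simp only [hsgn] at hdet2
  set N := I.restrictScalars K ⊔ Submodule.span K
    {f : MvPolynomial ↥V K | ∃ w, skewWeight n w < skewWeight n (e Fin.revPerm + u') ∧
      f = monomial w 1} with hN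
  have h1 : ∑ σ ∈ Finset.univ.erase Fin.revPerm,
      ((Equiv.Perm.sign σ : ℤ) : K) • (monomial (e σ + u') 1 : MvPolynomial ↥V K) ∈ N := by
    refine Submodule.sum_mem _ fun σ hσ => Submodule.smul_mem _ _ ?_
    refine Submodule.mem_sup_right (Submodule.subset_span ⟨_, ?_, rfl⟩)
    rw [map_add, map_add, hwt, hwt]
    simp only [Fin.revPerm_apply]
    exact Nat.add_lt_add_right (sum_mul_lt_sum_mul_rev hr hcc hn (Finset.ne_of_mem_erase hσ)) _
  have hIN : I.restrictScalars K ≤ N := le_sup_left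
  have h2 := hIN hdet2
  rw [Submodule.add_mem_iff_left _ h1] at h2
  have h3 := N.smul_mem ((Equiv.Perm.sign (Fin.revPerm (n := s)) : ℤ) : K) h2
  rw [smul_smul, ← Int.cast_mul, ← Units.val_mul, Int.units_mul_self] at h3
  simpa using h3

namespace LadderData

variable (D : LadderData)

theorem a_le (i : Fin D.h) : D.a i ≤ D.n := by
  rw [← D.a_last]
  exact D.a_mono.monotone (Fin.le_def.2 (by simp only; omega))

theorem b_pos (i : Fin D.h) : 1 ≤ D.b i := by
  rw [← D.b_first]
  exact D.b_mono.monotone (Fin.le_def.2 (Nat.zero_le _))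

/-- A minor all of whose skew-diagonal entries lie in `L_j` lies in `L_j`. -/
theorem mem_Lj_of_skewDiagonal {j : Fin D.k} {s : ℕ} {r cc : Fin s → ℕ} (hr : StrictMono r)
    (hcc : StrictMono cc) (h : ∀ k : Fin s, (r k, cc k.rev) ∈ D.Lj j) (k l : Fin s) :
    (r k, cc l) ∈ D.Lj j := by
  have hcol : ∀ l : Fin s, (r l.rev, cc l) ∈ D.Lj j := fun l => by simpa using h l.rev
  obtain ⟨⟨-, -, -, hm, -, -, h1, -, -, -⟩, h2, -⟩ := h k
  obtain ⟨⟨-, -, -, -, h3, -, -, -, -, h4⟩, -, h5⟩ := hcol l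
  have hs : 0 < s := k.pos
  let o : Fin s := ⟨0, hs⟩
  obtain ⟨⟨i, -, hb, -, -, ha, -⟩, -, -⟩ := h o
  have h6 : r o ≤ r k := hr.monotone (Fin.le_def.2 (Nat.zero_le _))
  have h7 : cc l ≤ cc o.rev := by
    refine hcc.monotone (Fin.le_def.2 ?_)
    simp only [Fin.val_rev, o]
    omega
  simp only at *
  exact ⟨⟨i, j, by simp only; omega, hm, h3, by simp only; omega, h1, h2, h5, h4⟩, h2, h5⟩

/-- A monomial in the indeterminates of the ladder is standard if it is not divisible by the
skew-diagonal of any of the minors generating the mixed ladder determinantal ideal. -/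
def IsStandard (u : ↥D.L →₀ ℕ) : Prop :=
  ∀ (j : Fin D.k) (r cc : Fin (D.t j) → ℕ), StrictMono r → StrictMono cc →
    (∀ k l, (r k, cc l) ∈ D.Lj j) → ∃ k : Fin (D.t j), ∀ v : ↥D.L, v.1 = (r k, cc k.rev) → u v = 0

theorem monomial_mem_sup_span_isStandard (K : Type*) [Field K] (u : ↥D.L →₀ ℕ) :
    (monomial u 1 : MvPolynomial ↥D.L K) ∈ (D.It K).restrictScalars K ⊔
      Submodule.span K {f | ∃ w, D.IsStandard w ∧ f = monomial w 1} := by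
  induction hn : skewWeight D.n u using Nat.strong_induction_on generalizing u with
  | _ N ih =>
  subst hn
  by_cases hstd : D.IsStandard u
  · exact Submodule.mem_sup_right (Submodule.subset_span ⟨u, hstd, rfl⟩)
  simp only [IsStandard] at hstd
  push Not at hstd
  obtain ⟨j, r, cc, hr, hcc, hmem, hu⟩ := hstd
  have hmem' : ∀ k l, (r k, cc l) ∈ D.L := fun k l => (hmem k l).1
  have hdet : (Matrix.of fun k l =>
      (X (⟨(r k, cc l), hmem' k l⟩ : ↥D.L) : MvPolynomial ↥D.L K)).det ∈ D.It K :=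
    Submodule.mem_iSup_of_mem (p := fun j => minorsIdeal K D.L (D.Lj j) (D.t j)) j
      (Ideal.subset_span ⟨r, cc, hr, hcc, hmem, hmem', rfl⟩)
  refine (sup_le le_sup_left (Submodule.span_le.2 ?_) : _ ≤ (D.It K).restrictScalars K ⊔
      Submodule.span K {f | ∃ w, D.IsStandard w ∧ f = monomial w 1})
    (monomial_mem_sup_span_of_skewDiagonal (n := D.n) hr hcc (fun l => ?_) hmem' hdet fun k => ?_)
  · rintro _ ⟨w, hw, rfl⟩
    exact ih _ hw w rfl
  · obtain ⟨-, -, -, -, -, -, -, -, -, h⟩ := hmem' l l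
    exact h
  · obtain ⟨v, hv, hne⟩ := hu k
    have : v = ⟨(r k, cc k.rev), hmem' k k.rev⟩ := Subtype.ext hv
    rwa [this] at hne

theorem exists_isStandard_sub_mem (K : Type*) [Field K] (f : MvPolynomial ↥D.L K) :
    ∃ g, f - g ∈ D.It K ∧ ∀ u ∈ g.support, D.IsStandard u := by
  have hf : f ∈ (D.It K).restrictScalars K ⊔
      Submodule.span K {f | ∃ w, D.IsStandard w ∧ f = monomial w 1} := by
    rw [f.as_sum]
    refine Submodule.sum_mem _ fun u _ => ?_
    rw [← mul_one (coeff u f), ← smul_eq_mul, ← smul_monomial]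
    exact Submodule.smul_mem _ _ (D.monomial_mem_sup_span_isStandard K u)
  obtain ⟨i, hi, g, hg, rfl⟩ := Submodule.mem_sup.1 hf
  refine ⟨g, by simpa using hi, ?_⟩
  have hle : Submodule.span K {f : MvPolynomial ↥D.L K | ∃ w, D.IsStandard w ∧ f = monomial w 1} ≤
      restrictSupport K {u | D.IsStandard u} := by
    rw [Submodule.span_le]
    rintro _ ⟨w, hw, rfl⟩
    exact (monomial_mem_restrictSupport K).2 (Or.inl hw)
  exact fun u hu => mem_restrictSupport_iff K |>.1 (hle hg) hu

/-- The rank conditions satisfied by the (reflected) generic point of the mixed ladder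
determinantal variety. -/
def rankConditions : Finset (ℕ × ℕ × ℕ) :=
  Finset.univ.image fun j => (D.d j + 1, D.n - D.c j + 1, D.t j - 1)

theorem rankIdeal_rankConditions_isPrime (K : Type u) [Field K] :
    (rankIdeal K D.rankConditions).IsPrime :=
  rankIdeal_isPrime K _ _ _ (fun _ _ hij => Nat.succ_le_succ (D.d_mono hij))
    (fun _ _ hij => Nat.succ_le_succ (Nat.sub_le_sub_left (D.c_mono hij) _))

/-- Reflection of the columns of a set of positions. -/
def reflect (V : Set (ℕ × ℕ)) (v : ↥V) : ℕ × ℕ := (v.1.1, D.n - v.1.2)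

theorem reflect_injective : Function.Injective (D.reflect D.L) := by
  intro v w hvw
  obtain ⟨-, -, -, -, -, -, -, -, -, hv⟩ := v.2
  obtain ⟨-, -, -, -, -, -, -, -, -, hw⟩ := w.2
  simp only [reflect, Prod.mk.injEq] at hvw
  exact Subtype.ext (Prod.ext hvw.1 (by omega))

/-- The minors defining the mixed ladder determinantal ideal vanish under the rank conditions. -/
theorem iSup_minorsIdeal_le_comap (K : Type u) [Field K] (V : Set (ℕ × ℕ))
    (S : Fin D.k → Set (ℕ × ℕ)) (hS : ∀ j, ∀ v ∈ S j, v.1 ≤ D.d j ∧ D.c j ≤ v.2) :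
    ⨆ j, minorsIdeal K V (S j) (D.t j) ≤
      (rankIdeal K D.rankConditions).comap (rename (D.reflect V)) := by
  refine iSup_le fun j => Ideal.span_le.2 ?_
  rintro _ ⟨r, cc, -, -, hrc, hmem, rfl⟩ F _ _ M hM
  have hj := hM _ (Finset.mem_image_of_mem _ (Finset.mem_univ j))
  have key := hj.det_eq_zero (Nat.sub_lt (D.t_pos j) Nat.one_pos) r (fun k => D.n - cc k)
    (fun k => Nat.lt_succ_of_le (hS j _ (hrc k k)).1)
    (fun k => Nat.lt_succ_of_le (Nat.sub_le_sub_left (hS j _ (hrc k k)).2 _))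
  rw [← key]
  change aeval _ (rename (D.reflect V) _) = _
  rw [aeval_rename, AlgHom.map_det]
  congr 1
  ext k l
  simp [reflect]

theorem isStandard_mapDomain {u : ↥D.L →₀ ℕ} (hu : D.IsStandard u) :
    _root_.IsStandard D.rankConditions (u.mapDomain (D.reflect D.L)) := by
  classical
  intro c hc s hs a b ha hb hac hbc
  obtain ⟨j, -, rfl⟩ := Finset.mem_image.1 hc
  obtain rfl : s = D.t j := hs.trans (Nat.sub_add_cancel (D.t_pos j))
  by_contra! hcon
  have hv : ∀ k, ∃ v : ↥D.L, u v ≠ 0 ∧ D.reflect D.L v = (a k, b k) := by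
    intro k
    have h1 := Finsupp.mapDomain_support (Finsupp.mem_support_iff.2 (hcon k))
    obtain ⟨v, hv, h⟩ := Finset.mem_image.1 h1
    exact ⟨v, Finsupp.mem_support_iff.1 hv, h⟩
  choose v hv0 hv using hv
  have hvn : ∀ k, (v k).1.2 ≤ D.n := fun k => by
    obtain ⟨-, -, -, -, -, -, -, -, -, h⟩ := (v k).2
    exact h
  have hv1 : ∀ k, (v k).1 = (a k, D.n - b k) := by
    intro k
    have h1 := hv k
    have h2 := hvn k
    simp only [reflect, Prod.mk.injEq] at h1
    exact Prod.ext h1.1 (by simp only; omega)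
  have hbn : ∀ k, b k ≤ D.n := fun k => by
    have h1 := hv k
    simp only [reflect, Prod.mk.injEq] at h1
    omega
  have hcc : StrictMono fun k : Fin (D.t j) => D.n - b k.rev := by
    intro k l hkl
    have h1 := hb (Fin.rev_lt_rev.2 hkl)
    have h2 := hbn k.rev
    simp only
    omega
  have hdiag : ∀ k : Fin (D.t j), (a k, D.n - b k.rev.rev) ∈ D.Lj j := by
    intro k
    rw [Fin.rev_rev, ← hv1]
    refine ⟨(v k).2, ?_, ?_⟩
    · rw [hv1]
      exact Nat.le_of_lt_succ (hac k)
    · rw [hv1]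
      have h1 := hbc k
      have h2 := D.c_le j
      simp only at h1 ⊢
      omega
  obtain ⟨k, hk⟩ := hu j a (fun k => D.n - b k.rev) ha hcc (D.mem_Lj_of_skewDiagonal ha hcc hdiag)
  exact hv0 k (hk (v k) (by simp only [Fin.rev_rev]; exact hv1 k))

/-- The mixed ladder determinantal ideal is the vanishing ideal of a set of rank conditions. -/
theorem comap_rankIdeal_eq_It (K : Type u) [Field K] :
    (rankIdeal K D.rankConditions).comap (rename (D.reflect D.L)) = D.It K := by
  classical
  have hle : D.It K ≤ (rankIdeal K D.rankConditions).comap (rename (D.reflect D.L)) :=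
    D.iSup_minorsIdeal_le_comap K D.L D.Lj fun j v hv => hv.2
  refine le_antisymm (fun f hf => ?_) hle
  obtain ⟨g, hfg, hg⟩ := D.exists_isStandard_sub_mem K f
  have hg0 : rename (D.reflect D.L) g = 0 := by
    refine eq_zero_of_mem_rankIdeal_of_isStandard D.rankConditions ?_ _ ?_ ?_
    · intro c hc c' hc'
      obtain ⟨j, -, rfl⟩ := Finset.mem_image.1 hc
      obtain ⟨j', -, rfl⟩ := Finset.mem_image.1 hc'
      rcases le_total j j' with h | h
      · have h1 := D.d_mono h
        have h2 := D.c_mono h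
        simp only
        omega
      · have h1 := D.d_mono h
        have h2 := D.c_mono h
        simp only
        omega
    · have h1 := Ideal.sub_mem _ hf (hle hfg)
      rwa [sub_sub_cancel, Ideal.mem_comap] at h1
    · intro u hu
      rw [support_rename_of_injective D.reflect_injective] at hu
      obtain ⟨w, hw, rfl⟩ := Finset.mem_image.1 hu
      exact D.isStandard_mapDomain (hg w hw)
  rw [map_eq_zero_iff _ (rename_injective _ D.reflect_injective)] at hg0
  rwa [hg0, sub_zero] at hfg

end LadderData

/-- **Theorem.** Let `X_j` be the smallest submatrix of `X` containing `L_j`, i.e.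
`X_j = {x_{b,a} : b_{l_j} ≤ b ≤ d_j, c_j ≤ a ≤ a_{h_j}}` where
`l_j = min {i : x_{b_i,a_i} ∈ L_j}` and `h_j = max {i : x_{b_i,a_i} ∈ L_j}`.
Let `X' = X_1 ∪ ⋯ ∪ X_k` and `I_t(X') = I_{t_1}(X_1) + ⋯ + I_{t_k}(X_k) ⊆ K[X']`.
Then `I_t(X') ∩ K[L] = I_t(L)`, where `K[L]` is viewed inside `K[X']` via the
inclusion of the sets of variables.  In particular `I_t(L)` is a prime ideal. -/
theorem mixedLadderDeterminantal_eq_contraction (K : Type*) [Field K]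
    (D : LadderData) (hnd : D.Nondeg)
    (lf hf : Fin D.k → Fin D.h)
    (hlf : ∀ j, IsLeast {i : Fin D.h | (D.b i, D.a i) ∈ D.Lj j} (lf j))
    (hhf : ∀ j, IsGreatest {i : Fin D.h | (D.b i, D.a i) ∈ D.Lj j} (hf j))
    (Xj : Fin D.k → Set (ℕ × ℕ))
    (hXj : ∀ j, Xj j =
      {p | D.b (lf j) ≤ p.1 ∧ p.1 ≤ D.d j ∧ D.c j ≤ p.2 ∧ p.2 ≤ D.a (hf j)})
    (X' : Set (ℕ × ℕ)) (hX' : X' = ⋃ j, Xj j)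
    (hsub : D.L ⊆ X') :
    Ideal.comap (MvPolynomial.rename (Set.inclusion hsub) : MvPolynomial ↥D.L K →ₐ[K] MvPolynomial ↥X' K)
        (⨆ j : Fin D.k, minorsIdeal K X' (Xj j) (D.t j)) = D.It K
      ∧ (D.It K).IsPrime := by
  have hLX : ∀ j, D.Lj j ⊆ Xj j := by
    rintro j p ⟨⟨i, -, h1, -, -, h2, -⟩, h3, h4⟩
    have hi : (D.b i, D.a i) ∈ D.Lj j :=
      ⟨⟨i, j, le_rfl, D.b_le i, D.a_pos i, le_rfl, D.b_pos i, h1.trans h3, h4.trans h2, D.a_le i⟩,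
        h1.trans h3, h4.trans h2⟩
    rw [hXj]
    exact ⟨(D.b_mono.monotone ((hlf j).2 hi)).trans h1, h3, h4,
      h2.trans (D.a_mono.monotone ((hhf j).2 hi))⟩
  refine ⟨le_antisymm (fun f hf => ?_) ?_, ?_⟩
  · have h1 := D.iSup_minorsIdeal_le_comap K X' Xj
      (fun j v hv => by
        rw [hXj] at hv
        exact ⟨hv.2.1, hv.2.2.1⟩) hf
    rw [← D.comap_rankIdeal_eq_It K, Ideal.mem_comap]
    rw [Ideal.mem_comap, rename_rename] at h1
    exact h1
  · refine iSup_le fun j => Ideal.span_le.2 ?_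
    rintro _ ⟨r, cc, hr, hcc, hrc, hmem, rfl⟩
    rw [SetLike.mem_coe, Ideal.mem_comap]
    refine Submodule.mem_iSup_of_mem (p := fun j => minorsIdeal K X' (Xj j) (D.t j)) j
      (Ideal.subset_span ⟨r, cc, hr, hcc, fun k l => hLX j (hrc k l),
        fun k l => hsub (hmem k l), ?_⟩)
    rw [AlgHom.map_det]
    congr 1
    ext1 k l
    simp
  · rw [← D.comap_rankIdeal_eq_It K]
    have := D.rankIdeal_rankConditions_isPrime K
    exact Ideal.comap_isPrime _ _
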